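/- For every θ ∈ (0,1) and every p ∈ [1,∞) there exist constants C = C(p,θ) > 0 and δ₀ = δ₀(p,θ) > 0 with the following property: if 0 < δ ≤ δ₀ and (I, ψ, m) satisfy the centering condition m((-∞, a_θ] ∩ I) = θ and the δ-deficit condition e^{-ψ(a_θ)} ≤ e^{-ψ_g(a_θ)} + δ, then the density f of m with respect to γ, given by f(x) = e^{ψ_g(x) - ψ(x)} for x ∈ I and f(x) = 0 for x ∉ I, satisfies (∫_ℝ |f(x) − 1|^p γ(dx))^{1/p} ≤ C · δ^{1/p}. -/

import Mathlib

open MeasureTheory Real Set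

/-- `gaussPsi x = x²/2 + (1/2)·log(2π)`, so that the standard Gaussian measure
is `exp (-gaussPsi x) dx`. -/
noncomputable def gaussPsi (x : ℝ) : ℝ := x ^ 2 / 2 + Real.log (2 * π) / 2

/-- The standard Gaussian measure `γ(dx) = (2π)^{-1/2} exp(-x²/2) dx` on `ℝ`. -/
noncomputable def gauss : Measure ℝ :=
  MeasureTheory.volume.withDensity fun x => ENNReal.ofReal (Real.exp (-gaussPsi x))

open ProbabilityTheory in
lemma gauss_eq : gauss = gaussianReal 0 1 := by
  rw [gaussianReal_of_var_ne_zero _ one_ne_zero, gauss]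
  congr 1
  ext x
  rw [gaussianPDF, gaussianPDFReal, gaussPsi]
  congr 1
  have h : (0:ℝ) < 2 * π := by positivity
  have : Real.exp (-(Real.log (2 * π) / 2)) = (√(2 * π))⁻¹ := by
    rw [Real.exp_neg, ← Real.log_sqrt h.le, Real.exp_log (Real.sqrt_pos.mpr h)]
  rw [neg_add, Real.exp_add, this, mul_comm]
  simp [neg_div]

instance gauss_prob : IsProbabilityMeasure gauss := by
  rw [gauss_eq]; infer_instance

lemma gauss_pos {s : Set ℝ} (hs : IsOpen s) (hn : s.Nonempty) : 0 < gauss s := by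
  rw [pos_iff_ne_zero]
  intro h
  rw [gauss_eq] at h
  exact (hs.measure_pos volume hn).ne'
    (ProbabilityTheory.gaussianReal_absolutelyContinuous' 0 one_ne_zero h)

lemma gauss_inj {a b : ℝ} (h : gauss (Iic a) = gauss (Iic b)) : a = b := by
  have key : ∀ {a b : ℝ}, gauss (Iic a) = gauss (Iic b) → ¬ a < b := by
    intro a b h hab
    have h1 : gauss (Iic a) + gauss (Ioo a b) ≤ gauss (Iic b) := by
      rw [← measure_union _ measurableSet_Ioo]
      · apply measure_mono
        rintro x (hx | hx)
        · exact le_trans hx hab.le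
        · exact hx.2.le
      · rw [Set.disjoint_left]
        intro x hx hx'
        exact absurd hx'.1 (not_lt.mpr hx)
    rw [← h] at h1
    have h2 := gauss_pos isOpen_Ioo (nonempty_Ioo.mpr hab)
    have h3 := ENNReal.lt_add_right (measure_ne_top gauss (Iic a)) h2.ne'
    exact absurd h1 (not_le.mpr h3)
  rcases lt_trichotomy a b with h' | h' | h'
  · exact absurd h' (key h)
  · exact h'
  · exact absurd h' (key h.symm)

lemma integrable_exp_abs (K a b : ℝ) (hK : 0 ≤ K) :
    Integrable (fun x => Real.exp (b + K * |x - a|)) gauss := by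
  have h1 : Integrable (fun x => Real.exp (b - K * a) * Real.exp (K * x)) gauss := by
    rw [gauss_eq]
    exact (ProbabilityTheory.integrable_exp_mul_gaussianReal K).const_mul _
  have h2 : Integrable (fun x => Real.exp (b + K * a) * Real.exp ((-K) * x)) gauss := by
    rw [gauss_eq]
    exact (ProbabilityTheory.integrable_exp_mul_gaussianReal (-K)).const_mul _
  refine (h1.add h2).mono' (by fun_prop) (ae_of_all _ fun x => ?_)
  simp only [Pi.add_apply, ← Real.exp_add, Real.norm_eq_abs, Real.abs_exp]
  rcases abs_cases (x - a) with ⟨h, _⟩ | ⟨h, _⟩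
  · rw [h]
    have : b + K * (x - a) = b - K * a + K * x := by ring
    rw [this]; linarith [Real.exp_pos (b + K * a + -K * x)]
  · rw [h]
    have : b + K * -(x - a) = b + K * a + -K * x := by ring
    rw [this]; linarith [Real.exp_pos (b - K * a + K * x)]

lemma slope_bound {γ : Measure ℝ} [IsProbabilityMeasure γ] {S T : Set ℝ}
    (hS : MeasurableSet S) (hT : MeasurableSet T) (hTS : T ⊆ S) {f : ℝ → ℝ}
    (hf : Integrable f γ) {a c η κ : ℝ} (hc : 0 ≤ c) (hη : 0 ≤ η) (hκ : 0 < κ) (hηκ : η ≤ κ / 2)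
    (hfS : ∀ x ∈ S, f x ≤ (1 + η) * Real.exp (-(c * |x - a|)))
    (hint : ∫ x in S, f x ∂γ = γ.real S) (hT1 : ∀ x ∈ T, 1 ≤ |x - a|)
    (hκT : κ ≤ γ.real T) : c ≤ 2 * η / κ := by
  set e := Real.exp (-c) with he
  have he0 : 0 < e := Real.exp_pos _
  have he1 : e ≤ 1 := Real.exp_le_one_iff.mpr (by linarith)
  have hi1 : Integrable (fun x => (1 + η) * (1 - T.indicator (fun _ => 1 - e) x)) (γ.restrict S) :=
    ((integrable_const _).sub ((integrable_const _).indicator hT)).const_mul _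
  have h1 : ∫ x in S, f x ∂γ ≤ ∫ x in S, (1 + η) * (1 - T.indicator (fun _ => 1 - e) x) ∂γ := by
    refine setIntegral_mono_on hf.integrableOn hi1 hS fun x hx => (hfS x hx).trans ?_
    refine mul_le_mul_of_nonneg_left ?_ (by linarith)
    by_cases hxT : x ∈ T
    · rw [indicator_of_mem hxT, he]
      have := hT1 x hxT
      have : Real.exp (-(c * |x - a|)) ≤ Real.exp (-c) := Real.exp_le_exp.mpr (by nlinarith)
      linarith
    · rw [indicator_of_notMem hxT, sub_zero]
      exact Real.exp_le_one_iff.mpr (by have := abs_nonneg (x - a); nlinarith)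
  rw [integral_const_mul, integral_sub (integrable_const _) ((integrable_const _).indicator hT),
    integral_indicator hT, Measure.restrict_restrict hT, inter_eq_left.mpr hTS, hint] at h1
  simp only [integral_const, smul_eq_mul, measureReal_restrict_apply_univ, mul_one] at h1
  have hS1 : γ.real S ≤ 1 := measureReal_le_one
  have hT0 : κ * (1 - e) ≤ γ.real T * (1 - e) := mul_le_mul_of_nonneg_right hκT (by linarith)
  have h2 : κ * (1 - e) ≤ η := by
    nlinarith [mul_nonneg hκ.le (sub_nonneg.mpr he1), mul_nonneg hη (mul_nonneg hκ.le (sub_nonneg.mpr he1))]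
  have h3 : 1 / 2 ≤ e := by nlinarith
  have h4 : c * e ≤ 1 - e := by
    have := Real.add_one_le_exp c
    have h5 : Real.exp c * e = 1 := by rw [he, ← Real.exp_add]; simp
    nlinarith
  rw [le_div_iff₀ hκ]
  nlinarith [mul_nonneg hc hκ.le]

lemma pointwise_bound {f H η p : ℝ} (hp : 1 ≤ p) (hf : 0 ≤ f) (hη : 0 ≤ η) (hη1 : η ≤ 1)
    (hH : 0 ≤ H) (hfH : f ≤ 1 + η * H) :
    |f - 1| ^ p ≤ η * (2 * H + H ^ p) - (f - 1) := by
  have hHp : 0 ≤ H ^ p := Real.rpow_nonneg hH p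
  have h0 := mul_nonneg hη hH
  have h00 := mul_nonneg hη hHp
  rcases le_total f 1 with h | h
  · rw [abs_of_nonpos (by linarith)]
    have : (-(f - 1)) ^ p ≤ (-(f - 1)) ^ (1:ℝ) :=
      Real.rpow_le_rpow_of_exponent_ge' (by linarith) (by linarith) zero_le_one hp
    rw [Real.rpow_one] at this
    linarith
  · rw [abs_of_nonneg (by linarith)]
    have h1 : (f - 1) ^ p ≤ (η * H) ^ p :=
      Real.rpow_le_rpow (by linarith) (by linarith) (by linarith)
    rw [Real.mul_rpow hη hH] at h1
    have h2 : η ^ p ≤ η ^ (1:ℝ) := Real.rpow_le_rpow_of_exponent_ge' hη hη1 zero_le_one hp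
    rw [Real.rpow_one] at h2
    have := mul_le_mul_of_nonneg_right h2 hHp
    linarith

/-- the growth bound -/
lemma growth_bound {η K s : ℝ} (hη : 0 ≤ η) (hη1 : η ≤ 1) (hK : 0 ≤ K) (hs : 0 ≤ s) :
    (1 + η) * Real.exp (K * η * s) ≤ 1 + η * Real.exp (2 + 2 * K * s) := by
  set w := 1 + K * s with hw
  have hw0 : 0 ≤ w := by positivity
  have h1 : (1 + η) * Real.exp (K * η * s) ≤ Real.exp (η * w) := by
    have : η * w = η + K * η * s := by rw [hw]; ring
    rw [this, Real.exp_add]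
    exact mul_le_mul_of_nonneg_right (by linarith [Real.add_one_le_exp η]) (Real.exp_pos _).le
  have h2 : Real.exp (η * w) ≤ 1 + η * w * Real.exp (η * w) := by
    have := Real.add_one_le_exp (-(η * w))
    have h5 : Real.exp (η * w) * Real.exp (-(η * w)) = 1 := by rw [← Real.exp_add]; simp
    nlinarith [Real.exp_pos (η * w)]
  have h3 : w * Real.exp (η * w) ≤ Real.exp (2 + 2 * K * s) := by
    have : 2 + 2 * K * s = w + w := by rw [hw]; ring
    rw [this, Real.exp_add]
    refine mul_le_mul (by linarith [Real.add_one_le_exp w]) (Real.exp_le_exp.mpr (by nlinarith))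
      (Real.exp_pos _).le (Real.exp_pos _).le
  nlinarith [mul_le_mul_of_nonneg_left h3 hη]

lemma convex_diff {I : Set ℝ} {ψ : ℝ → ℝ} (hI : Convex ℝ I)
    (h : ∀ x ∈ I, ∀ y ∈ I, ∀ t ∈ Ioo (0:ℝ) 1,
          ψ ((1 - t) * x + t * y)
            ≤ (1 - t) * ψ x + t * ψ y - (1 / 2) * (1 - t) * t * |x - y| ^ 2) :
    ConvexOn ℝ I (fun x => ψ x - gaussPsi x) := by
  rw [convexOn_iff_forall_pos]
  refine ⟨hI, fun x hx y hy s t hs ht hst => ?_⟩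
  have hs' : s = 1 - t := by linarith
  subst hs'
  have := h x hx y hy t ⟨ht, by linarith⟩
  rw [sq_abs] at this
  simp only [smul_eq_mul, gaussPsi]
  nlinarith

lemma subgradient {I : Set ℝ} {u : ℝ → ℝ} (hI : IsOpen I) (hu : ConvexOn ℝ I u) {a : ℝ}
    (ha : a ∈ I) : ∃ c : ℝ, ∀ x ∈ I, u a + c * (x - a) ≤ u x := by
  have hai : a ∈ interior I := by rwa [hI.interior_eq]
  refine ⟨derivWithin u (Ioi a) a, fun x hx => ?_⟩
  rcases lt_trichotomy x a with h | h | h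
  · have h1 := hu.slope_le_leftDeriv_of_mem_interior hx hai h
    have h2 := h1.trans (hu.leftDeriv_le_rightDeriv_of_mem_interior hai)
    rw [slope_def_field, div_le_iff₀ (by linarith)] at h2
    linarith
  · subst h; simp
  · have h1 := hu.rightDeriv_le_slope_of_mem_interior hai hx h
    rw [slope_def_field, le_div_iff₀ (by linarith)] at h1
    linarith

lemma density_meas {I : Set ℝ} {ψ : ℝ → ℝ} (hI : IsOpen I)
    (hu : ConvexOn ℝ I (fun x => ψ x - gaussPsi x)) :
    Measurable (I.indicator (fun y => Real.exp (gaussPsi y - ψ y))) := by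
  have hc : ContinuousOn (fun y => Real.exp (gaussPsi y - ψ y)) I := by
    have := (hu.continuousOn hI).neg.rexp
    refine this.congr fun x _ => ?_
    simp
  classical
  rw [← Set.piecewise_eq_indicator]
  exact hc.measurable_piecewise continuousOn_const hI.measurableSet

lemma density_eq {I : Set ℝ} {ψ : ℝ → ℝ} (hI : IsOpen I)
    (hm : Measurable (I.indicator (fun y => Real.exp (gaussPsi y - ψ y)))) :
    volume.withDensity (I.indicator fun x => ENNReal.ofReal (Real.exp (-ψ x))) =
    gauss.withDensity
      (fun x => ENNReal.ofReal (I.indicator (fun y => Real.exp (gaussPsi y - ψ y)) x)) := by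
  have hg : Measurable fun x => ENNReal.ofReal (Real.exp (-gaussPsi x)) := by
    unfold gaussPsi; fun_prop
  rw [gauss, ← withDensity_mul _ hg hm.ennreal_ofReal]
  congr 1
  ext x
  by_cases hx : x ∈ I
  · simp only [Pi.mul_apply, indicator_of_mem hx]
    rw [← ENNReal.ofReal_mul (Real.exp_pos _).le, ← Real.exp_add]
    congr 2; ring
  · simp [indicator_of_notMem hx]

/-- the `L^p`-estimate on an interval. -/
theorem lp_estimate_on_interval (θ p : ℝ) (hθ : θ ∈ Ioo (0:ℝ) 1) (hp : 1 ≤ p) :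
    ∃ C : ℝ, 0 < C ∧ ∃ δ₀ : ℝ, 0 < δ₀ ∧
      ∀ (δ : ℝ), 0 < δ → δ ≤ δ₀ →
      ∀ (I : Set ℝ) (ψ : ℝ → ℝ) (a : ℝ),
        IsOpen I → Convex ℝ I → a ∈ I →
        gauss (Iic a) = ENNReal.ofReal θ →
        (∀ x ∈ I, ∀ y ∈ I, ∀ t ∈ Ioo (0:ℝ) 1,
          ψ ((1 - t) * x + t * y)
            ≤ (1 - t) * ψ x + t * ψ y - (1 / 2) * (1 - t) * t * |x - y| ^ 2) →
        IsProbabilityMeasure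
          (MeasureTheory.volume.withDensity
            (I.indicator fun x => ENNReal.ofReal (Real.exp (-ψ x)))) →
        (MeasureTheory.volume.withDensity
            (I.indicator fun x => ENNReal.ofReal (Real.exp (-ψ x)))) (Iic a ∩ I)
          = ENNReal.ofReal θ →
        Real.exp (-ψ a) ≤ Real.exp (-gaussPsi a) + δ →
        (∫ x, |I.indicator (fun y => Real.exp (gaussPsi y - ψ y)) x - 1| ^ p ∂gauss) ^ (1 / p)
          ≤ C * δ ^ (1 / p) := by
  by_cases hex : ∃ a₀, gauss (Iic a₀) = ENNReal.ofReal θ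
  swap
  · exact ⟨1, one_pos, 1, one_pos, fun δ _ _ I ψ a _ _ _ ha => absurd ⟨a, ha⟩ hex⟩
  obtain ⟨a₀, ha₀⟩ := hex
  obtain ⟨κ, hκ0, hκ1, hκr, hκl⟩ : ∃ κ : ℝ, 0 < κ ∧ κ ≤ 1 ∧ κ ≤ gauss.real (Ioi (a₀ + 1)) ∧
      κ ≤ gauss.real (Iio (a₀ - 1)) := by
    refine ⟨min (gauss.real (Ioi (a₀ + 1))) (gauss.real (Iio (a₀ - 1))), ?_, ?_,
      min_le_left _ _, min_le_right _ _⟩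
    · exact lt_min (ENNReal.toReal_pos (gauss_pos isOpen_Ioi nonempty_Ioi).ne' (measure_ne_top _ _))
        (ENNReal.toReal_pos (gauss_pos isOpen_Iio nonempty_Iio).ne' (measure_ne_top _ _))
    · exact (min_le_left _ _).trans measureReal_le_one
  set G := Real.exp (-gaussPsi a₀) with hG
  have hG0 : 0 < G := Real.exp_pos _
  set K := 2 / κ with hK
  have hK0 : 0 < K := by positivity
  set H : ℝ → ℝ := fun x => Real.exp (2 + 2 * K * |x - a₀|) with hH
  have hH0 : ∀ x, 0 ≤ H x := fun x => (Real.exp_pos _).le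
  have hHi : Integrable H gauss := integrable_exp_abs _ _ _ (by positivity)
  have hHpi : Integrable (fun x => H x ^ p) gauss := by
    have := integrable_exp_abs (2 * K * p) a₀ (2 * p) (by positivity)
    refine this.congr (ae_of_all _ fun x => ?_)
    simp only [hH]
    rw [← Real.exp_mul]
    congr 1; ring
  set M := ∫ x, (2 * H x + H x ^ p) ∂gauss with hM
  have hMi : Integrable (fun x => 2 * H x + H x ^ p) gauss := (hHi.const_mul 2).add hHpi
  have hM0 : 0 ≤ M := integral_nonneg fun x =>
    add_nonneg (mul_nonneg zero_le_two (hH0 x)) (Real.rpow_nonneg (hH0 x) p)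
  refine ⟨(M / G) ^ (1 / p) + 1, by positivity, G * (κ / 2), by positivity, ?_⟩
  intro δ hδ hδ₀ I ψ a hIo hIc haI hga hψ hprob hmθ hdef
  obtain rfl : a = a₀ := gauss_inj (hga.trans ha₀.symm)
  have hu := convex_diff hIc hψ
  have hmeas := density_meas hIo hu
  rw [density_eq hIo hmeas] at hprob hmθ
  set f := I.indicator (fun y => Real.exp (gaussPsi y - ψ y)) with hf
  have hf0 : ∀ x, 0 ≤ f x := fun x => indicator_nonneg (fun y _ => (Real.exp_pos _).le) x
  have hl1 : ∫⁻ x, ENNReal.ofReal (f x) ∂gauss = 1 := by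
    have := hprob.measure_univ
    rwa [withDensity_apply _ MeasurableSet.univ, Measure.restrict_univ] at this
  have hfi : Integrable f gauss := by
    refine ⟨hmeas.aestronglyMeasurable, ?_⟩
    rw [hasFiniteIntegral_iff_ofReal (ae_of_all _ hf0), hl1]
    exact ENNReal.one_lt_top
  have hint1 : ∫ x, f x ∂gauss = 1 := by
    rw [integral_eq_lintegral_of_nonneg_ae (ae_of_all _ hf0) hmeas.aestronglyMeasurable, hl1]
    rfl
  have hgθ : gauss.real (Iic a) = θ := by
    rw [measureReal_def, ha₀, ENNReal.toReal_ofReal hθ.1.le]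
  have hintl : ∫ x in Iic a, f x ∂gauss = gauss.real (Iic a) := by
    have h1 : ∫ x in Iic a, f x ∂gauss = ∫ x in Iic a ∩ I, f x ∂gauss := by
      rw [hf, setIntegral_indicator hIo.measurableSet]
      refine (setIntegral_congr_fun (measurableSet_Iic.inter hIo.measurableSet) fun x hx => ?_).symm
      simp only [indicator_of_mem hx.2]
    rw [h1, hgθ, integral_eq_lintegral_of_nonneg_ae (ae_of_all _ hf0) hmeas.aestronglyMeasurable,
      ← withDensity_apply _ (measurableSet_Iic.inter hIo.measurableSet), hmθ,
      ENNReal.toReal_ofReal hθ.1.le]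
  have hintr : ∫ x in Ioi a, f x ∂gauss = gauss.real (Ioi a) := by
    have h1 := integral_add_compl (measurableSet_Iic (a := a)) hfi
    have h2 := probReal_compl_eq_one_sub (μ := gauss) (measurableSet_Iic (a := a))
    rw [compl_Iic] at h1 h2
    linarith
  set η := δ / G with hη
  have hη0 : 0 ≤ η := by positivity
  have hηκ : η ≤ κ / 2 := by rw [hη, div_le_iff₀ hG0]; linarith
  have hη1 : η ≤ 1 := by linarith
  have hfa : Real.exp (gaussPsi a - ψ a) ≤ 1 + η := by
    have h1 : Real.exp (gaussPsi a - ψ a) * G = Real.exp (-ψ a) := by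
      rw [hG, ← Real.exp_add]; congr 1; ring
    have h2 : η * G = δ := by rw [hη]; field_simp
    refine le_of_mul_le_mul_right ?_ hG0
    rw [h1, add_mul, h2]; linarith
  obtain ⟨c, hc⟩ := subgradient hIo hu haI
  have hfc : ∀ x, f x ≤ (1 + η) * Real.exp (-(c * (x - a))) := by
    intro x
    by_cases hx : x ∈ I
    · rw [hf, indicator_of_mem hx]
      have := hc x hx
      calc Real.exp (gaussPsi x - ψ x)
          ≤ Real.exp ((gaussPsi a - ψ a) + -(c * (x - a))) := Real.exp_le_exp.mpr (by linarith)
        _ = Real.exp (gaussPsi a - ψ a) * Real.exp (-(c * (x - a))) := Real.exp_add _ _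
        _ ≤ _ := mul_le_mul_of_nonneg_right hfa (Real.exp_pos _).le
    · rw [hf, indicator_of_notMem hx]
      positivity
  have hcb : |c| ≤ K * η := by
    have hKη : K * η = 2 * η / κ := by rw [hK]; ring
    rw [hKη]
    rcases le_total 0 c with h | h
    · refine slope_bound (a := a) measurableSet_Ioi measurableSet_Ioi
        (Ioi_subset_Ioi (by linarith : a ≤ a + 1)) hfi
        (abs_nonneg c) hη0 hκ0 hηκ ?_ hintr ?_ hκr
      · intro x hx
        rw [abs_of_nonneg h, abs_of_pos (sub_pos.mpr hx)]
        exact hfc x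
      · intro x hx
        have := mem_Ioi.mp hx
        exact le_trans (by linarith) (le_abs_self _)
    · refine slope_bound (a := a) measurableSet_Iic measurableSet_Iio
        (fun x hx => mem_Iic.mpr (by have := mem_Iio.mp hx; linarith)) hfi
        (abs_nonneg c) hη0 hκ0 hηκ ?_ hintl ?_ hκl
      · intro x hx
        rw [abs_of_nonpos h, abs_of_nonpos (sub_nonpos.mpr hx), neg_mul_neg]
        exact hfc x
      · intro x hx
        have := mem_Iio.mp hx
        exact le_trans (by linarith) (neg_le_abs _)
  have hfH : ∀ x, f x ≤ 1 + η * H x := by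
    intro x
    refine le_trans ((hfc x).trans ?_) (growth_bound hη0 hη1 hK0.le (abs_nonneg (x - a)))
    refine mul_le_mul_of_nonneg_left (Real.exp_le_exp.mpr ?_) (by linarith)
    calc -(c * (x - a)) ≤ |c * (x - a)| := neg_le_abs _
      _ = |c| * |x - a| := abs_mul _ _
      _ ≤ _ := mul_le_mul_of_nonneg_right hcb (abs_nonneg _)
  have hmain : ∫ x, |f x - 1| ^ p ∂gauss ≤ η * M := by
    have hfi1 : Integrable (fun x => f x - 1) gauss := hfi.sub (integrable_const _)
    have h1 : ∫ x, |f x - 1| ^ p ∂gauss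
        ≤ ∫ x, (η * (2 * H x + H x ^ p) - (f x - 1)) ∂gauss :=
      integral_mono_of_nonneg (ae_of_all _ fun x => Real.rpow_nonneg (abs_nonneg _) p)
        ((hMi.const_mul η).sub hfi1)
        (ae_of_all _ fun x => pointwise_bound hp (hf0 x) hη0 hη1 (hH0 x) (hfH x))
    rw [integral_sub (hMi.const_mul η) hfi1, integral_const_mul,
      integral_sub hfi (integrable_const _), hint1] at h1
    simpa using h1
  have hp0 : 0 ≤ 1 / p := by positivity
  calc (∫ x, |f x - 1| ^ p ∂gauss) ^ (1 / p) ≤ (η * M) ^ (1 / p) :=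
        Real.rpow_le_rpow (integral_nonneg fun x => Real.rpow_nonneg (abs_nonneg _) p) hmain hp0
    _ = (M / G * δ) ^ (1 / p) := by rw [hη]; congr 1; ring
    _ = (M / G) ^ (1 / p) * δ ^ (1 / p) := Real.mul_rpow (by positivity) hδ.le
    _ ≤ _ := mul_le_mul_of_nonneg_right (by linarith) (by positivity)
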